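/- arXiv:2505.07370 — 2 statements merged into one kernel-verified Lean document; each statement's English description precedes it below -/
import Mathlib

section
/- For every n ≥ 2 and every choice of nonnegative reals b_1^2,...,b_n^2 with Σ_{k=1}^n b_k^2 = n, if θ is uniformly distributed on the unit sphere S^{n-1} of R^n and V_n^2(θ) = Σ_{k=1}^n θ_k^2 b_k^2, then E[ sup_{t∈R} |Φ(t / V_n(θ)) − Φ(t)| ] ≤ (35√5/4) · (Σ_{k=1}^n (b_k^2 − 1)^2)^{1/2} / (n − 1), where Φ(t/V_n(θ)) denotes the distribution function at t of a centered Gaussian with variance V_n^2(θ) and Φ is the standard normal distribution function. -/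
open MeasureTheory ProbabilityTheory Finset
open scoped NNReal ENNReal

/-- The uniform (rotation invariant) probability measure on the unit sphere
`S^{n-1}` of `ℝ^n`, obtained by normalizing the spherical part of the Lebesgue
measure. -/
noncomputable def sphereUniform (n : ℕ) :
    Measure (Metric.sphere (0 : EuclideanSpace ℝ (Fin n)) 1) :=
  ((volume : Measure (EuclideanSpace ℝ (Fin n))).toSphere Set.univ)⁻¹ •
    (volume : Measure (EuclideanSpace ℝ (Fin n))).toSphere

/-- The distribution function at `t` of a centered Gaussian random variable
with variance `v` (for `v = 0` this is the distribution function of the Dirac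
mass at `0`). -/
noncomputable def gaussCDF (v : ℝ≥0) (t : ℝ) : ℝ :=
  ((gaussianReal 0 v) (Set.Iic t)).toReal

lemma gaussCDF_nonneg (v : ℝ≥0) (t : ℝ) : 0 ≤ gaussCDF v t := ENNReal.toReal_nonneg

lemma gaussCDF_le_one (v : ℝ≥0) (t : ℝ) : gaussCDF v t ≤ 1 :=
  measureReal_le_one (μ := gaussianReal 0 v) (s := Set.Iic t)

lemma gaussCDF_mono (v : ℝ≥0) : Monotone (gaussCDF v) := fun _ _ h =>
  measureReal_mono (μ := gaussianReal 0 v) (Set.Iic_subset_Iic.2 h)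

lemma abs_gaussCDF_sub_le_one (v w : ℝ≥0) (s t : ℝ) : |gaussCDF v s - gaussCDF w t| ≤ 1 := by
  rw [abs_le]
  constructor <;> linarith [gaussCDF_nonneg v s, gaussCDF_nonneg w t, gaussCDF_le_one v s,
    gaussCDF_le_one w t]

/-- Rescaling to the standard normal distribution. -/
lemma gaussCDF_sq_mul {σ : ℝ≥0} (hσ : 0 < σ) (t : ℝ) :
    gaussCDF (σ ^ 2) (σ * t) = gaussCDF 1 t := by
  have h : gaussianReal 0 (σ ^ 2) = (gaussianReal 0 1).map (fun x => (σ : ℝ) * x) := by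
    rw [gaussianReal_map_const_mul]
    congr 1
    · simp
    · ext; simp
  have hσ' : (0 : ℝ) < σ := hσ
  rw [gaussCDF, gaussCDF, h, Measure.map_apply (by fun_prop) measurableSet_Iic]
  congr 2
  ext x
  simp [mul_le_mul_iff_right₀ hσ']

lemma gaussianPDFReal_zero_one_le {m x : ℝ} (hm : 0 ≤ m) (hx : m ≤ |x|) :
    gaussianPDFReal 0 1 x ≤ Real.exp (-m ^ 2 / 2) := by
  rw [gaussianPDFReal_def]
  have h1 : (√(2 * Real.pi * (1 : ℝ≥0)))⁻¹ ≤ 1 := by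
    apply inv_le_one_of_one_le₀
    rw [Real.one_le_sqrt]
    simp only [NNReal.coe_one]
    linarith [Real.pi_gt_three]
  have h2 : Real.exp (-(x - 0) ^ 2 / (2 * (1 : ℝ≥0))) ≤ Real.exp (-m ^ 2 / 2) := by
    apply Real.exp_le_exp.2
    have : m ^ 2 ≤ x ^ 2 := (sq_le_sq₀ hm (abs_nonneg x)).2 hx |>.trans_eq (sq_abs x)
    simp only [NNReal.coe_one, sub_zero, mul_one]
    linarith
  exact (mul_le_mul h1 h2 (Real.exp_pos _).le zero_le_one).trans_eq (one_mul _)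

lemma gaussCDF_one_sub_le {a b m : ℝ} (hab : a ≤ b) (hm : 0 ≤ m)
    (h : ∀ x ∈ Set.Ioc a b, m ≤ |x|) :
    gaussCDF 1 b - gaussCDF 1 a ≤ (b - a) * Real.exp (-m ^ 2 / 2) := by
  have h1 : gaussCDF 1 b - gaussCDF 1 a = ∫ x in Set.Ioc a b, gaussianPDFReal 0 1 x := by
    have h2 := measureReal_sdiff (μ := gaussianReal 0 1) (Set.Iic_subset_Iic.2 hab)
      measurableSet_Iic
    rw [Set.Iic_sdiff_Iic, Measure.real, gaussianReal_apply_eq_integral _ one_ne_zero,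
      ENNReal.toReal_ofReal (integral_nonneg fun x => gaussianPDFReal_nonneg _ _ _)] at h2
    exact h2.symm
  rw [h1]
  have h3 := norm_setIntegral_le_of_norm_le_const (μ := volume) (f := gaussianPDFReal 0 1)
    (measure_Ioc_lt_top (a := a) (b := b)) (C := Real.exp (-m ^ 2 / 2)) (fun x hx => by
      rw [Real.norm_of_nonneg (gaussianPDFReal_nonneg _ _ _)]
      exact gaussianPDFReal_zero_one_le hm (h x hx))
  rw [Real.volume_real_Ioc_of_le hab, mul_comm] at h3
  exact (Real.le_norm_self _).trans h3

lemma mul_exp_neg_sq_div_two_le_one (m : ℝ) : m * Real.exp (-m ^ 2 / 2) ≤ 1 := by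
  have h := Real.add_one_le_exp (m ^ 2 / 2)
  have h2 : m ≤ Real.exp (m ^ 2 / 2) := by nlinarith [sq_nonneg (m - 1)]
  calc _ ≤ Real.exp (m ^ 2 / 2) * Real.exp (-m ^ 2 / 2) := by gcongr
    _ = 1 := by rw [← Real.exp_add]; simp [neg_div]

/-- The distribution function of the standard Gaussian is Lipschitz along dilations. -/
lemma abs_gaussCDF_one_mul_sub_le {c : ℝ} (hc : 1 ≤ c) (t : ℝ) :
    |gaussCDF 1 (c * t) - gaussCDF 1 t| ≤ c - 1 := by
  have key := mul_le_mul_of_nonneg_left (mul_exp_neg_sq_div_two_le_one |t|) (sub_nonneg.2 hc)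
  rcases le_total 0 t with ht | ht
  · have hle : t ≤ c * t := le_mul_of_one_le_left ht hc
    rw [abs_of_nonneg (sub_nonneg.2 (gaussCDF_mono 1 hle))]
    have := gaussCDF_one_sub_le hle (abs_nonneg t) (fun x hx => by
      rw [abs_of_nonneg ht]; exact hx.1.le.trans (le_abs_self x))
    rw [abs_of_nonneg ht] at *
    linarith
  · have hle : c * t ≤ t := by nlinarith
    rw [abs_sub_comm, abs_of_nonneg (sub_nonneg.2 (gaussCDF_mono 1 hle))]
    have := gaussCDF_one_sub_le hle (abs_nonneg t) (fun x hx => by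
      rw [abs_of_nonpos ht]; exact (neg_le_neg hx.2).trans (neg_le_abs x))
    rw [abs_of_nonpos ht] at *
    linarith

lemma abs_gaussCDF_sub_le (v : ℝ≥0) (t : ℝ) :
    |gaussCDF v t - gaussCDF 1 t| ≤ 2 * |(v : ℝ) - 1| := by
  rcases lt_or_ge v (1 / 4) with hv | hv
  · have hv' : (v : ℝ) < 1 / 4 := by exact_mod_cast hv
    have := abs_gaussCDF_sub_le_one v 1 t t
    linarith [neg_le_abs ((v : ℝ) - 1)]
  · obtain ⟨σ, rfl⟩ : ∃ σ : ℝ≥0, v = σ ^ 2 := ⟨NNReal.sqrt v, (NNReal.sq_sqrt v).symm⟩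
    have hv' : (1 / 4 : ℝ) ≤ (σ : ℝ) ^ 2 := by exact_mod_cast hv
    have hσ : (1 / 2 : ℝ) ≤ σ := by nlinarith [σ.coe_nonneg]
    have hpos : 0 < σ := by
      have : (0 : ℝ) < σ := by linarith
      exact_mod_cast this
    have hpos' : (0 : ℝ) < σ := hpos
    set s := t / σ with hs
    have hts : t = σ * s := by rw [hs]; field_simp
    have hscale : gaussCDF (σ ^ 2) t = gaussCDF 1 s := by rw [hts, gaussCDF_sq_mul hpos]
    rw [hscale]
    push_cast
    rcases le_total 1 (σ : ℝ) with h1 | h1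
    · have := abs_gaussCDF_one_mul_sub_le h1 s
      rw [hts, abs_sub_comm]
      have : (σ : ℝ) - 1 ≤ 2 * ((σ : ℝ) ^ 2 - 1) := by nlinarith
      linarith [le_abs_self ((σ : ℝ) ^ 2 - 1)]
    · have h2 : 1 ≤ (σ : ℝ)⁻¹ := (one_le_inv₀ hpos').2 h1
      have := abs_gaussCDF_one_mul_sub_le h2 t
      rw [inv_mul_eq_div, ← hs] at this
      have h3 : (σ : ℝ)⁻¹ - 1 ≤ 2 * (1 - (σ : ℝ) ^ 2) := by
        rw [← sub_nonneg]
        have : 2 * (1 - (σ : ℝ) ^ 2) - ((σ : ℝ)⁻¹ - 1)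
            = (1 - σ) * (2 * (1 + σ) * σ - 1) * (σ : ℝ)⁻¹ := by field_simp; ring
        rw [this]
        have : 0 ≤ 2 * (1 + (σ : ℝ)) * σ - 1 := by nlinarith
        have : 0 ≤ 1 - (σ : ℝ) := by linarith
        positivity
      linarith [neg_le_abs ((σ : ℝ) ^ 2 - 1)]

/-- The restriction of a linear isometric automorphism to the unit sphere. -/
def LinearIsometryEquiv.sphereMap {E : Type*} [NormedAddCommGroup E] [NormedSpace ℝ E]
    (e : E ≃ₗᵢ[ℝ] E) (u : Metric.sphere (0 : E) 1) : Metric.sphere (0 : E) 1 :=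
  ⟨e u, by simp⟩

lemma LinearIsometryEquiv.continuous_sphereMap {E : Type*} [NormedAddCommGroup E]
    [NormedSpace ℝ E] (e : E ≃ₗᵢ[ℝ] E) : Continuous e.sphereMap :=
  (e.continuous.comp continuous_subtype_val).subtype_mk _

open scoped Pointwise in
lemma toSphere_map_sphereMap {E : Type*} [NormedAddCommGroup E] [InnerProductSpace ℝ E]
    [FiniteDimensional ℝ E] [MeasurableSpace E] [BorelSpace E] (e : E ≃ₗᵢ[ℝ] E) :
    (volume : Measure E).toSphere.map e.sphereMap = (volume : Measure E).toSphere := by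
  ext s hs
  rw [Measure.map_apply e.continuous_sphereMap.measurable hs, Measure.toSphere_apply' _ hs,
    ← e.measurePreserving.measure_preimage_equiv (f := e.toHomeomorph.toMeasurableEquiv),
    Measure.toSphere_apply' _ (e.continuous_sphereMap.measurable hs)]
  congr 2
  ext x
  simp only [Set.mem_smul, Set.mem_image, Set.mem_preimage]
  change (∃ r ∈ Set.Ioo (0 : ℝ) 1, ∃ y, (∃ u, e.sphereMap u ∈ s ∧ (u : E) = y) ∧ r • y = x) ↔
    ∃ r ∈ Set.Ioo (0 : ℝ) 1, ∃ y, (∃ u ∈ s, (u : E) = y) ∧ r • y = e x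
  constructor
  · rintro ⟨r, hr, _, ⟨u, hu, rfl⟩, rfl⟩
    exact ⟨r, hr, _, ⟨_, hu, rfl⟩, (e.map_smul r (u : E)).symm⟩
  · rintro ⟨r, hr, _, ⟨u, hu, rfl⟩, hx⟩
    refine ⟨r, hr, _, ⟨e.symm.sphereMap u, ?_, rfl⟩, ?_⟩
    · have : e.sphereMap (e.symm.sphereMap u) = u := Subtype.ext (e.apply_symm_apply u)
      rwa [this]
    · apply e.injective
      rw [e.map_smul]
      exact (congrArg (r • ·) (e.apply_symm_apply (u : E))).trans hx

lemma sphereUniform_map_sphereMap {n : ℕ}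
    (e : EuclideanSpace ℝ (Fin n) ≃ₗᵢ[ℝ] EuclideanSpace ℝ (Fin n)) :
    (sphereUniform n).map e.sphereMap = sphereUniform n := by
  rw [sphereUniform, Measure.map_smul, toSphere_map_sphereMap]

lemma isProbabilityMeasure_sphereUniform {n : ℕ} (hn : n ≠ 0) :
    IsProbabilityMeasure (sphereUniform n) := by
  have : Nonempty (Fin n) := ⟨⟨0, Nat.pos_of_ne_zero hn⟩⟩
  have : Nontrivial (EuclideanSpace ℝ (Fin n)) := inferInstance
  constructor
  rw [sphereUniform, Measure.smul_apply, smul_eq_mul]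
  exact ENNReal.inv_mul_cancel (Measure.measure_univ_ne_zero.2 (Measure.toSphere_ne_zero _)) (measure_ne_top _ _)

section Moments

variable {n : ℕ}

lemma Continuous.integrable_sphereUniform (hn : n ≠ 0)
    {f : Metric.sphere (0 : EuclideanSpace ℝ (Fin n)) 1 → ℝ}
    (hf : Continuous f) : Integrable f (sphereUniform n) := by
  have := isProbabilityMeasure_sphereUniform hn
  exact hf.integrable_of_hasCompactSupport (HasCompactSupport.of_compactSpace f)

lemma integral_inner_pow_sphereUniform_congr {v w : EuclideanSpace ℝ (Fin n)} (h : ‖v‖ = ‖w‖)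
    (k : ℕ) :
    ∫ u, inner ℝ v u.1 ^ k ∂(sphereUniform n)
      = ∫ u, inner ℝ w u.1 ^ k ∂(sphereUniform n) := by
  set e := Submodule.reflection (Submodule.span ℝ {v - w})ᗮ
  have he : e v = w := Submodule.reflection_sub h
  nth_rw 2 [← sphereUniform_map_sphereMap e]
  rw [integral_map e.continuous_sphereMap.aemeasurable (by fun_prop)]
  refine integral_congr_ae (.of_forall fun u => ?_)
  change _ = inner ℝ w (e u.1) ^ k
  rw [← he, e.inner_map_map]

lemma integral_inner_pow_four_sphereUniform (v w : EuclideanSpace ℝ (Fin n)) (hw : ‖w‖ = 1) :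
    ∫ u, inner ℝ v u.1 ^ 4 ∂(sphereUniform n)
      = ‖v‖ ^ 4 * ∫ u, inner ℝ w u.1 ^ 4 ∂(sphereUniform n) := by
  rw [integral_inner_pow_sphereUniform_congr (w := ‖v‖ • w) (by simp [norm_smul, hw]),
    ← integral_const_mul]
  simp only [real_inner_smul_left, mul_pow]

lemma integral_coord_pow_four_eq (i j : Fin n) :
    ∫ u, u.1 i ^ 4 ∂(sphereUniform n)
      = ∫ u, u.1 j ^ 4 ∂(sphereUniform n) := by
  have := integral_inner_pow_sphereUniform_congr (v := EuclideanSpace.single i (1 : ℝ))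
    (w := EuclideanSpace.single j (1 : ℝ)) (by simp) 4
  simpa [EuclideanSpace.inner_single_left] using this

lemma integral_coord_sq_mul_coord_sq {i j : Fin n} (hij : i ≠ j) :
    ∫ u, u.1 i ^ 2 * u.1 j ^ 2 ∂(sphereUniform n)
      = (∫ u, u.1 i ^ 4 ∂(sphereUniform n)) / 3 := by
  have hn : n ≠ 0 := fun h => (h ▸ i).elim0
  have key (s : ℝ) (hs : s ^ 2 = 1) :
      ∫ u, (u.1 i + s * u.1 j) ^ 4 ∂(sphereUniform n)
        = 4 * ∫ u, u.1 i ^ 4 ∂(sphereUniform n) := by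
    have h := integral_inner_pow_four_sphereUniform
      (EuclideanSpace.single i (1 : ℝ) + s • EuclideanSpace.single j (1 : ℝ))
      (EuclideanSpace.single i (1 : ℝ)) (by simp)
    have hnorm : ‖EuclideanSpace.single i (1 : ℝ) + s • EuclideanSpace.single j (1 : ℝ)‖ ^ 4
        = 4 := by
      have : ‖EuclideanSpace.single i (1 : ℝ) + s • EuclideanSpace.single j (1 : ℝ)‖ ^ 2 = 2 := by
        rw [norm_add_sq_real, real_inner_smul_right, norm_smul, mul_pow]
        simp [EuclideanSpace.inner_single_left, hij, hs]
        norm_num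
      rw [show (4 : ℕ) = 2 * 2 from rfl, pow_mul, this]
      norm_num
    rw [hnorm] at h
    simpa [inner_add_left, real_inner_smul_left, EuclideanSpace.inner_single_left] using h
  have h1 := key 1 (by norm_num)
  have h2 := key (-1) (by norm_num)
  have hsum : ∀ u : Metric.sphere (0 : EuclideanSpace ℝ (Fin n)) 1,
      (u.1 i + 1 * u.1 j) ^ 4 + (u.1 i + -1 * u.1 j) ^ 4
        = 2 * u.1 i ^ 4 + 2 * u.1 j ^ 4 + 12 * (u.1 i ^ 2 * u.1 j ^ 2) := by
    intro u; ring
  have h3 := integral_congr_ae (μ := sphereUniform n) (.of_forall hsum)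
  rw [integral_add, integral_add, integral_add, integral_const_mul, integral_const_mul,
    integral_const_mul, h1, h2, ← integral_coord_pow_four_eq i j] at h3
  · linarith
  all_goals exact Continuous.integrable_sphereUniform hn (by fun_prop)

lemma sum_coord_sq_sphere (u : Metric.sphere (0 : EuclideanSpace ℝ (Fin n)) 1) :
    ∑ i, u.1 i ^ 2 = 1 := by
  rw [← EuclideanSpace.real_norm_sq_eq, norm_eq_of_mem_sphere, one_pow]

lemma integral_sq_sum_sphereUniform (c : Fin n → ℝ) (k : Fin n) :
    ∫ u, (∑ i, u.1 i ^ 2 * c i) ^ 2 ∂(sphereUniform n)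
      = (∫ u, u.1 k ^ 4 ∂(sphereUniform n)) / 3
        * ((∑ i, c i) ^ 2 + 2 * ∑ i, c i ^ 2) := by
  have hn : n ≠ 0 := fun h => (h ▸ k).elim0
  set A := ∫ u, u.1 k ^ 4 ∂(sphereUniform n) with hA
  have hmom (i j : Fin n) :
      ∫ u, u.1 i ^ 2 * u.1 j ^ 2 ∂(sphereUniform n)
        = A / 3 + if i = j then 2 * A / 3 else 0 := by
    split_ifs with h
    · subst h
      rw [hA, integral_coord_pow_four_eq k i]
      simp only [← pow_add]
      ring
    · rw [integral_coord_sq_mul_coord_sq h, hA, integral_coord_pow_four_eq k i, add_zero]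
  have hexp (u : Metric.sphere (0 : EuclideanSpace ℝ (Fin n)) 1) : (∑ i, u.1 i ^ 2 * c i) ^ 2
      = ∑ i, ∑ j, (c i * c j) * (u.1 i ^ 2 * u.1 j ^ 2) := by
    rw [sq, Finset.sum_mul_sum]
    exact Finset.sum_congr rfl fun i _ => Finset.sum_congr rfl fun j _ => by ring
  simp only [hexp]
  rw [integral_finsetSum _ fun i _ => Continuous.integrable_sphereUniform hn (by fun_prop)]
  have hrow (i : Fin n) : ∫ u,
      ∑ j, (c i * c j) * (u.1 i ^ 2 * u.1 j ^ 2) ∂(sphereUniform n)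
        = A / 3 * (c i * ∑ j, c j) + 2 * A / 3 * c i ^ 2 := by
    rw [integral_finsetSum _ fun i _ => Continuous.integrable_sphereUniform hn (by fun_prop)]
    simp only [integral_const_mul, hmom, mul_add, Finset.sum_add_distrib]
    simp only [mul_ite, mul_zero, Finset.sum_ite_eq, Finset.mem_univ, if_true, Finset.mul_sum]
    congr 1
    · exact Finset.sum_congr rfl fun j _ => by ring
    · ring
  simp only [hrow, Finset.sum_add_distrib, ← Finset.mul_sum, ← Finset.sum_mul]
  ring

lemma integral_coord_pow_four_sphereUniform (k : Fin n) :
    ∫ u, u.1 k ^ 4 ∂(sphereUniform n) = 3 / (n * (n + 2)) := by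
  have hn : n ≠ 0 := fun h => (h ▸ k).elim0
  have := isProbabilityMeasure_sphereUniform hn
  have h := integral_sq_sum_sphereUniform (fun _ => 1) k
  simp only [mul_one, sum_coord_sq_sphere, one_pow, integral_const, probReal_univ, smul_eq_mul,
    Finset.sum_const, Finset.card_univ, Fintype.card_fin, nsmul_eq_mul] at h
  have : (n : ℝ) ≠ 0 := Nat.cast_ne_zero.2 hn
  field_simp
  linarith

end Moments

lemma integral_abs_le_sqrt_integral_sq {Ω : Type*} [MeasurableSpace Ω] {μ : Measure Ω}
    [IsProbabilityMeasure μ] {X : Ω → ℝ} (hX : MemLp X 2 μ) :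
    ∫ ω, |X ω| ∂μ ≤ √(∫ ω, X ω ^ 2 ∂μ) := by
  apply Real.le_sqrt_of_sq_le
  have h := variance_nonneg |X| μ
  rw [variance_eq_sub hX.abs] at h
  simpa using h

/-- Inequality (1.7) of Remark 2.2: comparison between the conditional Gaussian
`N_θ` (variance `V_n²(θ) = Σ θ_k² b_k²`) and the standard Gaussian, in expected
Kolmogorov distance over `θ` uniform on the sphere. -/
theorem expected_kolmogorov_dist_gauss_mixture (n : ℕ) (hn : 2 ≤ n)
    (b2 : Fin n → ℝ) (hb2 : ∀ k, 0 ≤ b2 k) (hsum : ∑ k, b2 k = (n : ℝ)) :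
    (∫ u : Metric.sphere (0 : EuclideanSpace ℝ (Fin n)) 1,
        (⨆ t : ℝ,
          |gaussCDF (Real.toNNReal (∑ k, ((u : EuclideanSpace ℝ (Fin n)) k) ^ 2 * b2 k)) t - gaussCDF 1 t|)
        ∂(sphereUniform n)) ≤
      (35 * Real.sqrt 5 / 4) * Real.sqrt (∑ k, (b2 k - 1) ^ 2) / (n - 1) := by
  have hn0 : n ≠ 0 := by lia
  have := isProbabilityMeasure_sphereUniform hn0
  set X : Metric.sphere (0 : EuclideanSpace ℝ (Fin n)) 1 → ℝ := fun u =>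
    ∑ k, ((u : EuclideanSpace ℝ (Fin n)) k) ^ 2 * (b2 k - 1) with hX
  have hXc : Continuous X := by fun_prop
  have hXL : MemLp X 2 (sphereUniform n) :=
    hXc.memLp_of_hasCompactSupport (HasCompactSupport.of_compactSpace X)
  have hXV (u : Metric.sphere (0 : EuclideanSpace ℝ (Fin n)) 1) :
      ((Real.toNNReal (∑ k, ((u : EuclideanSpace ℝ (Fin n)) k) ^ 2 * b2 k) : ℝ≥0) : ℝ) - 1
        = X u := by
    rw [Real.coe_toNNReal _ (Finset.sum_nonneg fun k _ => mul_nonneg (sq_nonneg _) (hb2 k))]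
    simp only [hX, mul_sub, mul_one, Finset.sum_sub_distrib, sum_coord_sq_sphere]
  have h1 := integral_mono_of_nonneg (μ := sphereUniform n)
    (.of_forall fun u => Real.iSup_nonneg fun t => abs_nonneg _)
    ((hXc.abs.const_mul 2).integrable_sphereUniform hn0) (.of_forall fun u =>
      ciSup_le fun t => (abs_gaussCDF_sub_le (Real.toNNReal
        (∑ k, ((u : EuclideanSpace ℝ (Fin n)) k) ^ 2 * b2 k)) t).trans_eq (by rw [hXV u]))
  refine h1.trans ?_
  rw [integral_const_mul]
  have h2 := integral_abs_le_sqrt_integral_sq hXL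
  have hc : ∑ k, (b2 k - 1) = 0 := by simp [Finset.sum_sub_distrib, hsum]
  rw [integral_sq_sum_sphereUniform _ ⟨0, by lia⟩, integral_coord_pow_four_sphereUniform, hc] at h2
  set S := ∑ k, (b2 k - 1) ^ 2
  have hS : 0 ≤ S := Finset.sum_nonneg fun k _ => sq_nonneg _
  have hn' : (2 : ℝ) ≤ n := by exact_mod_cast hn
  have hpos : (0 : ℝ) < n - 1 := by linarith
  have h3 : √(3 / ((n : ℝ) * (n + 2)) / 3 * (0 ^ 2 + 2 * S)) ≤ 2 * √S / (n - 1) := by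
    apply Real.sqrt_le_iff.2 ⟨by positivity, ?_⟩
    rw [div_pow, mul_pow, Real.sq_sqrt hS]
    calc 3 / ((n : ℝ) * (n + 2)) / 3 * (0 ^ 2 + 2 * S) = 2 * S / (n * (n + 2)) := by
          field_simp; ring
      _ ≤ 2 ^ 2 * S / (n - 1) ^ 2 := by
          gcongr
          · norm_num
          · nlinarith
  have h5 : 1 ≤ √5 := Real.one_le_sqrt.2 (by norm_num)
  calc 2 * ∫ u, |X u| ∂(sphereUniform n) ≤ 2 * (2 * √S / (n - 1)) := by linarith
    _ = 4 * √S / (n - 1) := by ring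
    _ ≤ 35 * √5 / 4 * √S / (n - 1) := by
        gcongr
        linarith
end

section
/- Let p > 2 and n ≥ 20. There exists a probability space carrying random variables d_1,...,d_n such that: (1) E(d_k | σ(d_1,...,d_{k-1})) = 0 and E(d_k^2 | σ(d_1,...,d_{k-1})) = 1 almost surely for every 1 ≤ k ≤ n; (2) sup_{1≤k≤n} E(|d_k|^p) ≤ E(|Y|^p) + 5^{p-2}, where Y is a standard normal random variable; (3) sup_{t∈R} |P(S_n ≤ t√n) − Φ(t)| ≥ 0.06 · n^{−(p−2)/(2p−2)}, where S_n = Σ_{k=1}^n d_k and Φ is the standard normal distribution function. -/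
open MeasureTheory ProbabilityTheory Finset
open scoped NNReal ENNReal

/-! ### Gaussian estimates -/

lemma gaussianPDFReal_zero_le (v : ℝ≥0) (x : ℝ) :
    gaussianPDFReal 0 v x ≤ (√(2 * Real.pi * v))⁻¹ := by
  rw [gaussianPDFReal]
  refine mul_le_of_le_one_right (by positivity) ?_
  rw [Real.exp_le_one_iff]
  have : 0 ≤ (x - 0) ^ 2 / (2 * (v : ℝ)) := by positivity
  rw [neg_div]
  linarith

lemma gaussianReal_zero_Icc_le {v : ℝ≥0} (hv : v ≠ 0) {c d : ℝ} (hcd : c ≤ d) :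
    (gaussianReal 0 v).real (Set.Icc c d) ≤ (d - c) * (√(2 * Real.pi * v))⁻¹ := by
  have h0 : 0 ≤ (√(2 * Real.pi * v))⁻¹ := by positivity
  rw [Measure.real, gaussianReal_apply 0 hv]
  refine ENNReal.toReal_le_of_le_ofReal (mul_nonneg (by linarith) h0) ?_
  calc ∫⁻ x in Set.Icc c d, gaussianPDF 0 v x
      ≤ ∫⁻ _ in Set.Icc c d, ENNReal.ofReal (√(2 * Real.pi * v))⁻¹ :=
        lintegral_mono fun x => ENNReal.ofReal_le_ofReal (gaussianPDFReal_zero_le v x)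
    _ = ENNReal.ofReal ((d - c) * (√(2 * Real.pi * v))⁻¹) := by
        rw [setLIntegral_const, Real.volume_Icc, mul_comm, ENNReal.ofReal_mul (by linarith)]

lemma gaussianReal_zero_Ioi_zero {v : ℝ≥0} (hv : v ≠ 0) :
    (gaussianReal 0 v).real (Set.Ioi 0) = 1 / 2 := by
  have := nullSingletonClass_gaussianReal (μ := 0) hv
  have hneg : (gaussianReal 0 v).real (Set.Iio 0) = (gaussianReal 0 v).real (Set.Ioi 0) := by
    have h : (gaussianReal 0 v).map (fun x => -x) = gaussianReal 0 v := by
      rw [gaussianReal_map_neg, neg_zero]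
    conv_lhs => rw [← h, map_measureReal_apply measurable_neg measurableSet_Iio]
    congr 1
    ext x
    simp
  have hIic : (gaussianReal 0 v).real (Set.Iic 0) = (gaussianReal 0 v).real (Set.Iio 0) :=
    measureReal_congr Iio_ae_eq_Iic.symm
  have hc := probReal_compl_eq_one_sub (μ := gaussianReal 0 v) (measurableSet_Iic (a := (0 : ℝ)))
  rw [Set.compl_Iic] at hc
  linarith

lemma le_gaussianReal_zero_Ioi {v : ℝ≥0} (hv : v ≠ 0) {y : ℝ} (hy : 0 ≤ y) :
    1 / 2 - y * (√(2 * Real.pi * v))⁻¹ ≤ (gaussianReal 0 v).real (Set.Ioi y) := by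
  have h1 : (gaussianReal 0 v).real (Set.Ioi 0) ≤
      (gaussianReal 0 v).real (Set.Icc 0 y) + (gaussianReal 0 v).real (Set.Ioi y) := by
    refine (measureReal_mono fun x hx => ?_).trans (measureReal_union_le _ _)
    rcases le_or_gt x y with h | h
    · exact Or.inl ⟨le_of_lt hx, h⟩
    · exact Or.inr h
  have h2 := gaussianReal_zero_Icc_le hv hy
  rw [gaussianReal_zero_Ioi_zero hv] at h1
  rw [sub_zero] at h2
  linarith

/-- On the window `|x| ≤ √N / 2`, the centered Gaussian density of variance `m` dominates the
maximum of the centered Gaussian density of variance `m + N`. -/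
lemma le_gaussianPDFReal_zero_of_abs_le {m N : ℝ≥0} (hm : m ≠ 0) (hN : (N : ℝ) ≤ 3 * m) {x : ℝ}
    (hx : |x| ≤ √N / 2) :
    (√(2 * Real.pi * (m + N)))⁻¹ ≤ gaussianPDFReal 0 m x := by
  have hm0 : (0 : ℝ) < m := by positivity
  have hN0 : (0 : ℝ) ≤ N := N.2
  have hx2 : x ^ 2 ≤ N / 4 := by
    have h := pow_le_pow_left₀ (abs_nonneg x) hx 2
    rw [sq_abs, div_pow, Real.sq_sqrt hN0] at h
    linarith
  set r : ℝ := N / m with hr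
  have hr0 : 0 ≤ r := by positivity
  have hr3 : r ≤ 3 := by rw [hr, div_le_iff₀ hm0]; exact hN
  have hexp : 1 - r / 8 ≤ Real.exp (-(x - 0) ^ 2 / (2 * m)) := by
    have h1 : -(r / 8) ≤ -(x - 0) ^ 2 / (2 * m) := by
      rw [hr, sub_zero, neg_div, neg_le_neg_iff, div_div,
        div_le_div_iff₀ (by positivity) (by positivity)]
      nlinarith
    have h2 := Real.add_one_le_exp (-(r / 8))
    have h3 := Real.exp_le_exp.2 h1
    linarith
  have hsq : 1 ≤ √(1 + r) * (1 - r / 8) := by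
    rw [← Real.sqrt_sq (show (0 : ℝ) ≤ 1 - r / 8 by linarith), ← Real.sqrt_mul (by linarith),
      Real.one_le_sqrt]
    nlinarith [mul_nonneg hr0 (sub_nonneg.2 hr3), mul_nonneg hr0 (mul_nonneg hr0 hr0)]
  have hsplit : √(2 * Real.pi * (m + N)) = √(2 * Real.pi * m) * √(1 + r) := by
    rw [← Real.sqrt_mul (by positivity)]
    congr 1
    rw [hr]
    field_simp
  rw [gaussianPDFReal, hsplit, mul_inv]
  refine mul_le_mul_of_nonneg_left ?_ (by positivity)
  rw [inv_le_iff_one_le_mul₀' (by positivity)]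
  exact hsq.trans (mul_le_mul_of_nonneg_left hexp (by positivity))

lemma le_prod_gaussianReal_window {m N : ℝ≥0} (hm : m ≠ 0) (hN0 : N ≠ 0) (hN : (N : ℝ) ≤ 3 * m)
    {T : ℝ} (hT : √N / 2 ≤ T)
    (hTN : T * (√(2 * Real.pi * N))⁻¹ ≤ 1 / 2 - √N / 2 * (√(2 * Real.pi * N))⁻¹) :
    (√(2 * Real.pi * (m + N)))⁻¹ * (√N * (1 / 2 - T * (√(2 * Real.pi * N))⁻¹)) ≤
      ((gaussianReal 0 m).prod (gaussianReal 0 N)).real {z | |z.1| ≤ √N / 2 ∧ T < z.1 + z.2} := by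
  set w : ℝ := √N / 2 with hw
  set κ : ℝ := (√(2 * Real.pi * N))⁻¹ with hκ
  set c : ℝ := (√(2 * Real.pi * (m + N)))⁻¹ with hc
  have hκ0 : 0 ≤ κ := by positivity
  have hc0 : 0 ≤ c := by positivity
  have hw0 : 0 ≤ w := by positivity
  have hmeas : MeasurableSet {z : ℝ × ℝ | |z.1| ≤ w ∧ T < z.1 + z.2} := by
    exact (measurableSet_le (f := fun z : ℝ × ℝ => |z.1|) (by fun_prop) measurable_const).inter
      (measurableSet_lt (g := fun z : ℝ × ℝ => z.1 + z.2) measurable_const (by fun_prop))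
  have hint : ∫ x in Set.Icc (-w) w, c * (1 / 2 - (T - x) * κ) =
      c * (√N * (1 / 2 - T * κ)) := by
    rw [integral_Icc_eq_integral_Ioc, ← intervalIntegral.integral_of_le (by linarith)]
    have : ∀ x : ℝ, c * (1 / 2 - (T - x) * κ) = c * (1 / 2 - T * κ) + (c * κ) * x := fun x => by ring
    simp_rw [this]
    rw [intervalIntegral.integral_add (Continuous.intervalIntegrable (by fun_prop) _ _)
      (Continuous.intervalIntegrable (by fun_prop) _ _), intervalIntegral.integral_const,
      intervalIntegral.integral_const_mul (c * κ) (fun x => x), integral_id, hw, smul_eq_mul]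
    ring
  rw [← hint, Measure.real, Measure.prod_apply hmeas]
  refine (ENNReal.ofReal_le_iff_le_toReal ?_).1 ?_
  · rw [← Measure.prod_apply hmeas]
    exact measure_ne_top _ _
  rw [ofReal_integral_eq_lintegral_ofReal (by
      exact (Continuous.continuousOn (by fun_prop)).integrableOn_Icc) (by
      filter_upwards [ae_restrict_mem measurableSet_Icc] with x hx
      refine mul_nonneg hc0 ?_
      have : (T - x) * κ ≤ (T + w) * κ := mul_le_mul_of_nonneg_right (by linarith [hx.1]) hκ0
      linarith)]
  rw [gaussianReal_of_var_ne_zero 0 hm, lintegral_withDensity_eq_lintegral_mul _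
    (measurable_gaussianPDF 0 m) (measurable_measure_prodMk_left hmeas)]
  refine le_trans ?_ (setLIntegral_le_lintegral (Set.Icc (-w) w) _)
  refine setLIntegral_mono' measurableSet_Icc fun x hx => ?_
  have hxw : |x| ≤ w := abs_le.2 hx
  have hpre : Prod.mk x ⁻¹' {z : ℝ × ℝ | |z.1| ≤ w ∧ T < z.1 + z.2} = Set.Ioi (T - x) := by
    ext y
    simp only [Set.mem_preimage, Set.mem_ofPred_eq, hxw, true_and, Set.mem_Ioi]
    constructor <;> intro h <;> linarith
  rw [Pi.mul_apply, hpre, ENNReal.ofReal_mul hc0]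
  refine mul_le_mul' (ENNReal.ofReal_le_ofReal (le_gaussianPDFReal_zero_of_abs_le hm hN hxw)) ?_
  rw [← ofReal_measureReal]
  exact ENNReal.ofReal_le_ofReal (le_gaussianReal_zero_Ioi hN0 (by linarith [hx.2]))

/-! ### A skewed two-point law -/

/-- The centered law with unit variance supported on `{1 / b, -b}`. -/
noncomputable def twoPoint (b : ℝ) : Measure ℝ :=
  ENNReal.ofReal (b ^ 2 / (1 + b ^ 2)) • Measure.dirac (1 / b) +
    ENNReal.ofReal (1 / (1 + b ^ 2)) • Measure.dirac (-b)

instance (b : ℝ) : IsProbabilityMeasure (twoPoint b) where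
  measure_univ := by
    have h : (0 : ℝ) < 1 + b ^ 2 := by positivity
    simp only [twoPoint, Measure.coe_add, Measure.coe_smul, Pi.add_apply, Pi.smul_apply,
      measure_univ, smul_eq_mul, mul_one]
    rw [← ENNReal.ofReal_add (by positivity) (by positivity), ← ENNReal.ofReal_one]
    congr 1
    field_simp
    ring

lemma integrable_twoPoint (b : ℝ) (f : ℝ → ℝ) : Integrable f (twoPoint b) :=
  ((integrable_dirac (by simp)).smul_measure (by simp)).add_measure
    ((integrable_dirac (by simp)).smul_measure (by simp))

lemma integral_twoPoint (b : ℝ) (f : ℝ → ℝ) :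
    ∫ x, f x ∂(twoPoint b) = b ^ 2 / (1 + b ^ 2) * f (1 / b) + 1 / (1 + b ^ 2) * f (-b) := by
  have h : (0 : ℝ) < 1 + b ^ 2 := by positivity
  rw [twoPoint, integral_add_measure ((integrable_dirac (by simp)).smul_measure (by simp))
    ((integrable_dirac (by simp)).smul_measure (by simp)), integral_smul_measure,
    integral_smul_measure, integral_dirac, integral_dirac,
    ENNReal.toReal_ofReal (by positivity), ENNReal.toReal_ofReal (by positivity), smul_eq_mul,
    smul_eq_mul]

lemma ae_twoPoint_le {b : ℝ} (hb : 0 < b) : ∀ᵐ x ∂(twoPoint b), x ≤ 1 / b := by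
  have h : 0 < 1 / b := by positivity
  rw [twoPoint, ae_add_measure_iff]
  refine ⟨Measure.ae_smul_measure ?_ _, Measure.ae_smul_measure ?_ _⟩
  · simp [ae_dirac_eq]
  · rw [ae_dirac_eq]
    change -b ≤ 1 / b
    linarith

lemma integral_id_twoPoint {b : ℝ} (hb : 0 < b) : ∫ x, x ∂(twoPoint b) = 0 := by
  rw [integral_twoPoint b fun x => x]
  field_simp
  ring

lemma integral_sq_twoPoint {b : ℝ} (hb : 0 < b) : ∫ x, x ^ 2 ∂(twoPoint b) = 1 := by
  rw [integral_twoPoint b fun x => x ^ 2]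
  field_simp

lemma integral_abs_rpow_twoPoint_le {b p : ℝ} (hb : 1 ≤ b) (hp : 2 ≤ p) :
    ∫ x, |x| ^ p ∂(twoPoint b) ≤ b ^ (p - 2) := by
  have hb0 : 0 < b := by linarith
  rw [integral_twoPoint b fun x => |x| ^ p]
  have h1 : |1 / b| ^ p ≤ 1 / b ^ 2 := by
    rw [abs_of_pos (by positivity), Real.div_rpow (by norm_num) hb0.le, Real.one_rpow]
    refine one_div_le_one_div_of_le (by positivity) ?_
    rw [← Real.rpow_natCast]
    exact Real.rpow_le_rpow_of_exponent_le hb (by simpa using hp)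
  have h2 : |-b| ^ p = b ^ (p - 2) * b ^ 2 := by
    rw [abs_neg, abs_of_pos hb0, ← Real.rpow_natCast b 2, ← Real.rpow_add hb0]
    norm_num
  have h3 : 1 ≤ b ^ (p - 2) := Real.one_le_rpow hb (by linarith)
  have h4 : 0 < 1 + b ^ 2 := by positivity
  calc b ^ 2 / (1 + b ^ 2) * |1 / b| ^ p + 1 / (1 + b ^ 2) * |-b| ^ p
      ≤ b ^ 2 / (1 + b ^ 2) * (1 / b ^ 2) + 1 / (1 + b ^ 2) * (b ^ (p - 2) * b ^ 2) := by
        rw [h2]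
        gcongr
    _ = (1 + b ^ (p - 2) * b ^ 2) / (1 + b ^ 2) := by field_simp
    _ ≤ b ^ (p - 2) := by
        rw [div_le_iff₀ h4]
        linarith

/-! ### Choice of the parameters -/

lemma exists_block_length {p : ℝ} (hp : 2 < p) {n : ℕ} (hn : 20 ≤ n) :
    ∃ (a : ℝ) (N : ℕ), 1 ≤ a ∧ a ^ (p - 1) = √n ∧
      (n : ℝ) ^ (-(p - 2) / (2 * p - 2)) = a / √n ∧
      a ^ 2 / 2 ≤ N ∧ (N : ℝ) ≤ a ^ 2 ∧ (N : ℝ) ≤ n / 2 + 1 := by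
  have hn0 : (20 : ℝ) ≤ n := by exact_mod_cast hn
  have hn1 : (0 : ℝ) < n := by linarith
  have hp1 : 2 * p - 2 ≠ 0 := by linarith
  set a : ℝ := (n : ℝ) ^ (1 / (2 * p - 2)) with ha
  have ha1 : 1 ≤ a := Real.one_le_rpow (by linarith) (by
    have : 0 < 2 * p - 2 := by linarith
    positivity)
  have han : a ^ 2 ≤ n := by
    rw [ha, ← Real.rpow_mul_natCast hn1.le]
    conv_rhs => rw [← Real.rpow_one (n : ℝ)]
    refine Real.rpow_le_rpow_of_exponent_le (by linarith) ?_
    rw [div_mul_eq_mul_div, div_le_one (by linarith)]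
    push_cast
    linarith
  refine ⟨a, ⌈a ^ 2 / 2⌉₊, ha1, ?_, ?_, Nat.le_ceil _, ?_, ?_⟩
  · rw [ha, ← Real.rpow_mul hn1.le, Real.sqrt_eq_rpow]
    congr 1
    have : p - 1 ≠ 0 := by linarith
    rw [show 2 * p - 2 = 2 * (p - 1) by ring]
    field_simp
  · rw [ha, Real.sqrt_eq_rpow, ← Real.rpow_sub hn1]
    congr 1
    have h2 : p - 1 ≠ 0 := by linarith
    rw [show 2 * p - 2 = 2 * (p - 1) by ring]
    field_simp
    ring
  · rcases le_or_gt (a ^ 2 / 2) 1 with h | h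
    · have : ⌈a ^ 2 / 2⌉₊ ≤ 1 := Nat.ceil_le.2 (by simpa using h)
      have h' : ((⌈a ^ 2 / 2⌉₊ : ℕ) : ℝ) ≤ 1 := by exact_mod_cast this
      nlinarith
    · have := Nat.ceil_lt_add_one (show 0 ≤ a ^ 2 / 2 by positivity)
      linarith
  · have := Nat.ceil_lt_add_one (show 0 ≤ a ^ 2 / 2 by positivity)
    linarith

lemma sqrt_two_pi_bounds : 2.5 ≤ √(2 * Real.pi) ∧ √(2 * Real.pi) ≤ 2.51 := by
  have h1 := Real.pi_gt_d6
  have h2 := Real.pi_lt_d6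
  constructor
  · exact Real.le_sqrt_of_sq_le (by norm_num; linarith)
  · rw [Real.sqrt_le_left (by norm_num)]
    norm_num
    linarith

/-! ### Switching between two innovations on a past event -/

section Switch

variable {Ω : Type*} {mΩ : MeasurableSpace Ω} {μ : Measure Ω} [IsProbabilityMeasure μ]
  {F : MeasurableSpace Ω}

open Classical in
/-- If `A` is an event of the past `F` and `f`, `g` are independent of `F` with the same mean `c`,
then `f` on `A` and `g` off `A` have conditional expectation `c` given any sub-σ-algebra of `F`. -/
lemma condExp_piecewise_of_indep {m : MeasurableSpace Ω} (hmF : m ≤ F) (hF : F ≤ mΩ)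
    {A : Set Ω} (hA : MeasurableSet[F] A) {G : MeasurableSpace Ω} (hG : G ≤ mΩ)
    (hGF : Indep G F μ) {f g : Ω → ℝ}
    (hf : Integrable f μ) (hg : Integrable g μ) (hfG : StronglyMeasurable[G] f)
    (hgG : StronglyMeasurable[G] g) {c : ℝ} (hfc : ∫ ω, f ω ∂μ = c) (hgc : ∫ ω, g ω ∂μ = c) :
    μ[A.piecewise f g | m] =ᵐ[μ] fun _ => c := by
  have hsum : A.piecewise f g = A.indicator f + Aᶜ.indicator g := by
    funext ω
    by_cases hω : ω ∈ A <;> simp [hω]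
  have hF' : μ[A.piecewise f g | F] =ᵐ[μ] fun _ => c := by
    rw [hsum]
    filter_upwards [condExp_add (hf.indicator (hF _ hA)) (hg.indicator (hF _ hA.compl)) F,
      condExp_indicator hf hA, condExp_indicator hg hA.compl,
      condExp_indep_eq hG hF hfG hGF, condExp_indep_eq hG hF hgG hGF] with ω h h1 h2 h3 h4
    rw [h, Pi.add_apply, h1, h2]
    by_cases hω : ω ∈ A
    · simp [hω, h3, hfc]
    · simp [hω, h4, hgc]
  calc μ[A.piecewise f g | m] =ᵐ[μ] μ[μ[A.piecewise f g | F] | m] :=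
        (condExp_condExp_of_le hmF hF).symm
    _ =ᵐ[μ] μ[fun _ => c | m] := condExp_congr_ae hF'
    _ =ᵐ[μ] fun _ => c := by rw [condExp_const (hmF.trans hF)]

open Classical in
lemma integral_piecewise_le_of_indep (hF : F ≤ mΩ)
    {A : Set Ω} (hA : MeasurableSet[F] A) {G : MeasurableSpace Ω} (hG : G ≤ mΩ)
    (hGF : Indep G F μ) {f g : Ω → ℝ} (hf : Integrable f μ) (hg : Integrable g μ)
    (hfG : StronglyMeasurable[G] f) (hg0 : 0 ≤ g) :
    ∫ ω, A.piecewise f g ω ∂μ ≤ ∫ ω, g ω ∂μ + μ.real A * ∫ ω, f ω ∂μ := by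
  have hfA : ∫ ω in A, f ω ∂μ = μ.real A * ∫ ω, f ω ∂μ := by
    rw [← setIntegral_condExp hF hf hA,
      setIntegral_congr_ae (g := fun _ => ∫ ω, f ω ∂μ) (hF _ hA)
        ((condExp_indep_eq hG hF hfG hGF).mono fun ω h _ => h),
      setIntegral_const, smul_eq_mul]
  rw [integral_piecewise (hF _ hA) hf.integrableOn hg.integrableOn, hfA]
  have := setIntegral_le_integral (s := Aᶜ) hg (Filter.Eventually.of_forall hg0)
  linarith

end Switch

/-! ### Sums of independent Gaussian variables -/

lemma map_sum_gaussianReal {Ω ι : Type*} {mΩ : MeasurableSpace Ω} {μ : Measure Ω}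
    [IsProbabilityMeasure μ] {Y : ι → Ω → ℝ} (hY : ∀ i, Measurable (Y i)) (hind : iIndepFun Y μ)
    (hlaw : ∀ i, μ.map (Y i) = gaussianReal 0 1) (s : Finset ι) :
    μ.map (∑ i ∈ s, Y i) = gaussianReal 0 (s.card : ℝ≥0) := by
  classical
  induction s using Finset.induction_on with
  | empty =>
    rw [Finset.sum_empty, Finset.card_empty, Nat.cast_zero, gaussianReal_zero_var]
    exact (Measure.map_const μ 0).trans (by simp)
  | insert i s hi ih =>
    have h := gaussianReal_add_gaussianReal_of_indepFun
      (hind.indepFun_finsetSum_of_notMem hY hi).symm (hlaw i) ih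
    rw [Finset.sum_insert hi, Finset.card_insert_of_notMem hi, h, zero_add, Nat.cast_succ, add_comm]

/-! ### The construction -/

section Construction

/-- The law of the innovations: independent pairs made of a standard Gaussian variable and a
two-point variable. -/
noncomputable abbrev innovationLaw (n : ℕ) (b : ℝ) : Measure (Fin n → ℝ × ℝ) :=
  Measure.pi fun _ => (gaussianReal 0 1).prod (twoPoint b)

/-- The sum of the first `m` Gaussian innovations. -/
def gaussianBlock {n : ℕ} (m : ℕ) (ω : Fin n → ℝ × ℝ) : ℝ :=
  ∑ j with j.val < m, (ω j).1

/-- The event on which the `k`-th increment is taken from the two-point innovation. -/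
def switchEvent {n : ℕ} (m : ℕ) (r : ℝ) (k : Fin n) : Set (Fin n → ℝ × ℝ) :=
  {ω | m ≤ k.val ∧ |gaussianBlock m ω| ≤ r}

open Classical in
/-- The martingale increments: Gaussian, except that after time `m` they are two-point variables
when the sum of the first `m` terms lies in `[-r, r]`. -/
noncomputable def switchedIncrement {n : ℕ} (m : ℕ) (r : ℝ) (k : Fin n) :
    (Fin n → ℝ × ℝ) → ℝ :=
  (switchEvent m r k).piecewise (fun ω => (ω k).2) (fun ω => (ω k).1)

/-- The σ-algebra generated by the innovations strictly before `k`. -/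
@[reducible]
def pastInnovations {n : ℕ} (k : Fin n) : MeasurableSpace (Fin n → ℝ × ℝ) :=
  ⨆ j ∈ {j : Fin n | j.val < k.val}, MeasurableSpace.comap (fun ω => ω j) inferInstance

variable {n : ℕ} {m : ℕ} {r b : ℝ}

lemma pastInnovations_le (k : Fin n) : pastInnovations k ≤ MeasurableSpace.pi :=
  iSup₂_le fun j _ => (measurable_pi_apply j).comap_le

lemma pastInnovations_mono {j k : Fin n} (h : j.val ≤ k.val) :
    pastInnovations j ≤ pastInnovations k :=
  biSup_mono fun _ hi => lt_of_lt_of_le hi h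

lemma measurable_eval_pastInnovations {j k : Fin n} (h : j.val < k.val) :
    Measurable[pastInnovations k] fun ω : Fin n → ℝ × ℝ => ω j :=
  Measurable.of_comap_le (le_biSup (fun j : Fin n =>
    MeasurableSpace.comap (fun ω : Fin n → ℝ × ℝ => ω j) inferInstance) h)

lemma measurableSet_switchEvent_past (k : Fin n) :
    MeasurableSet[pastInnovations k] (switchEvent m r k) := by
  by_cases hk : m ≤ k.val
  · have hX : Measurable[pastInnovations k] (gaussianBlock (n := n) m) :=
      Finset.measurable_fun_sum _ fun j hj => measurable_fst.comp
        (measurable_eval_pastInnovations (((Finset.mem_filter.1 hj).2).trans_le hk))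
    simp only [switchEvent, hk, true_and]
    exact measurableSet_le (@Measurable.comp _ _ _ (pastInnovations k) _ _ _ _ measurable_abs hX)
      measurable_const
  · simp [switchEvent, hk]

open Classical in
lemma switchedIncrement_of_window {k : Fin n} {ω : Fin n → ℝ × ℝ} (hk : m ≤ k.val)
    (hω : |gaussianBlock m ω| ≤ r) : switchedIncrement m r k ω = (ω k).2 :=
  Set.piecewise_eq_of_mem _ _ _ ⟨hk, hω⟩

open Classical in
lemma switchedIncrement_of_not_window {k : Fin n} {ω : Fin n → ℝ × ℝ}
    (h : ¬ (m ≤ k.val ∧ |gaussianBlock m ω| ≤ r)) : switchedIncrement m r k ω = (ω k).1 :=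
  Set.piecewise_eq_of_notMem _ _ _ h

lemma measurable_switchedIncrement (k : Fin n) : Measurable (switchedIncrement m r k) := by
  classical
  exact Measurable.piecewise (pastInnovations_le k _ (measurableSet_switchEvent_past k))
    (by fun_prop) (by fun_prop)

lemma measurable_switchedIncrement_past {j k : Fin n} (h : j.val < k.val) :
    Measurable[pastInnovations k] (switchedIncrement m r j) := by
  classical
  have hW := measurable_eval_pastInnovations h
  exact @Measurable.piecewise _ _ _ _ _ (pastInnovations k) _ _
    (pastInnovations_mono h.le _ (measurableSet_switchEvent_past j))
    (measurable_snd.comp hW) (measurable_fst.comp hW)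

lemma iSup_comap_switchedIncrement_le (k : Fin n) :
    (⨆ j : Fin n, ⨆ _ : j.val < k.val,
      MeasurableSpace.comap (switchedIncrement m r j) inferInstance) ≤ pastInnovations k :=
  iSup₂_le fun _ hj => (measurable_switchedIncrement_past hj).comap_le

lemma iIndepFun_innovation (n : ℕ) (b : ℝ) :
    iIndepFun (fun (k : Fin n) (ω : Fin n → ℝ × ℝ) => ω k) (innovationLaw n b) :=
  iIndepFun_pi (X := fun _ x => x) fun _ => aemeasurable_id

lemma indep_innovation_past (k : Fin n) :
    Indep (MeasurableSpace.comap (fun ω : Fin n → ℝ × ℝ => ω k) inferInstance)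
      (pastInnovations k) (innovationLaw n b) := by
  have h := indep_iSup_of_disjoint (S := {k}) (T := {j : Fin n | j.val < k.val})
    (fun j => (measurable_pi_apply (X := fun _ : Fin n => ℝ × ℝ) j).comap_le)
    (iIndepFun_innovation n b).iIndep (by simp)
  simpa [pastInnovations] using h

lemma measurePreserving_gaussian (k : Fin n) :
    MeasurePreserving (fun ω : Fin n → ℝ × ℝ => (ω k).1) (innovationLaw n b) (gaussianReal 0 1) :=
  measurePreserving_fst.comp (measurePreserving_eval _ k)

lemma measurePreserving_twoPoint (k : Fin n) :
    MeasurePreserving (fun ω : Fin n → ℝ × ℝ => (ω k).2) (innovationLaw n b) (twoPoint b) :=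
  measurePreserving_snd.comp (measurePreserving_eval _ k)

lemma integrable_comp_gaussian (k : Fin n) {f : ℝ → ℝ} (hf : Integrable f (gaussianReal 0 1)) :
    Integrable (fun ω : Fin n → ℝ × ℝ => f (ω k).1) (innovationLaw n b) :=
  (measurePreserving_gaussian k).integrable_comp_of_integrable hf

lemma integral_comp_gaussian (k : Fin n) {f : ℝ → ℝ} (hf : Measurable f) :
    ∫ ω : Fin n → ℝ × ℝ, f (ω k).1 ∂(innovationLaw n b) = ∫ x, f x ∂(gaussianReal 0 1) := by
  have h := measurePreserving_gaussian (b := b) k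
  rw [← h.map_eq, integral_map h.measurable.aemeasurable hf.aestronglyMeasurable]

lemma integrable_comp_twoPoint (k : Fin n) (f : ℝ → ℝ) :
    Integrable (fun ω : Fin n → ℝ × ℝ => f (ω k).2) (innovationLaw n b) :=
  (measurePreserving_twoPoint k).integrable_comp_of_integrable (integrable_twoPoint b f)

lemma integral_comp_twoPoint (k : Fin n) {f : ℝ → ℝ} (hf : Measurable f) :
    ∫ ω : Fin n → ℝ × ℝ, f (ω k).2 ∂(innovationLaw n b) = ∫ x, f x ∂(twoPoint b) := by
  have h := measurePreserving_twoPoint (b := b) k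
  rw [← h.map_eq, integral_map h.measurable.aemeasurable hf.aestronglyMeasurable]

lemma stronglyMeasurable_comp_innovation (k : Fin n) {f : ℝ × ℝ → ℝ} (hf : Measurable f) :
    StronglyMeasurable[MeasurableSpace.comap (fun ω : Fin n → ℝ × ℝ => ω k) inferInstance]
      (fun ω => f (ω k)) :=
  (hf.comp (comap_measurable _)).stronglyMeasurable

open Classical in
lemma comp_switchedIncrement (f : ℝ → ℝ) (k : Fin n) :
    (fun ω => f (switchedIncrement m r k ω)) =
      (switchEvent m r k).piecewise (fun ω => f (ω k).2) (fun ω => f (ω k).1) := by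
  funext ω
  by_cases h : ω ∈ switchEvent m r k <;> simp [switchedIncrement, h]

lemma condExp_comp_switchedIncrement (k : Fin n) {f : ℝ → ℝ} (hf : Measurable f)
    (hfi : Integrable f (gaussianReal 0 1)) {c : ℝ} (hY : ∫ x, f x ∂(gaussianReal 0 1) = c)
    (hZ : ∫ x, f x ∂(twoPoint b) = c) :
    (innovationLaw n b)[fun ω => f (switchedIncrement m r k ω) | ⨆ j : Fin n, ⨆ _ : j.val < k.val,
      MeasurableSpace.comap (switchedIncrement m r j) inferInstance]
      =ᵐ[innovationLaw n b] fun _ => c := by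
  rw [comp_switchedIncrement]
  exact condExp_piecewise_of_indep (iSup_comap_switchedIncrement_le k) (pastInnovations_le k)
    (measurableSet_switchEvent_past k) (measurable_pi_apply k).comap_le (indep_innovation_past k)
    (integrable_comp_twoPoint k f) (integrable_comp_gaussian k hfi)
    (stronglyMeasurable_comp_innovation k (f := fun x => f x.2) (hf.comp measurable_snd))
    (stronglyMeasurable_comp_innovation k (f := fun x => f x.1) (hf.comp measurable_fst))
    ((integral_comp_twoPoint k hf).trans hZ) ((integral_comp_gaussian k hf).trans hY)

lemma integral_abs_rpow_switchedIncrement_le (k : Fin n) {p : ℝ} (hp : 2 ≤ p) (hb : 1 ≤ b) :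
    ∫ ω, |switchedIncrement m r k ω| ^ p ∂(innovationLaw n b) ≤
      ∫ x, |x| ^ p ∂(gaussianReal 0 1) +
        (innovationLaw n b).real (switchEvent m r k) * b ^ (p - 2) := by
  have hmeas : Measurable fun x : ℝ => |x| ^ p := by fun_prop
  have hint : Integrable (fun x : ℝ => |x| ^ p) (gaussianReal 0 1) := by
    have h := (memLp_id_gaussianReal (μ := 0) (v := 1) p.toNNReal).integrable_norm_rpow'
    simpa [Real.coe_toNNReal p (by linarith)] using h
  rw [comp_switchedIncrement (fun x => |x| ^ p)]
  refine (integral_piecewise_le_of_indep (pastInnovations_le k)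
    (measurableSet_switchEvent_past k) (measurable_pi_apply k).comap_le (indep_innovation_past k)
    (integrable_comp_twoPoint k fun x => |x| ^ p) (integrable_comp_gaussian k hint)
    (stronglyMeasurable_comp_innovation k (f := fun x => |x.2| ^ p) (by fun_prop))
    fun ω => by positivity).trans ?_
  rw [integral_comp_gaussian k hmeas, integral_comp_twoPoint k hmeas]
  gcongr
  exact integral_abs_rpow_twoPoint_le hb hp

lemma iIndepFun_gaussian (n : ℕ) (b : ℝ) :
    iIndepFun (fun (k : Fin n) (ω : Fin n → ℝ × ℝ) => (ω k).1) (innovationLaw n b) :=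
  (iIndepFun_innovation n b).comp (fun _ x => x.1) fun _ => measurable_fst

lemma map_sum_innovation (s : Finset (Fin n)) :
    (innovationLaw n b).map (fun ω => ∑ i ∈ s, (ω i).1) = gaussianReal 0 (s.card : ℝ≥0) := by
  rw [← map_sum_gaussianReal (fun i => by fun_prop) (iIndepFun_gaussian n b)
    (fun i => (measurePreserving_gaussian i).map_eq) s]
  congr 1
  funext ω
  simp

/-- The sum of the Gaussian innovations after time `m`. -/
def gaussianTail (m : ℕ) (ω : Fin n → ℝ × ℝ) : ℝ :=
  ∑ j with ¬ j.val < m, (ω j).1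

lemma gaussianBlock_add_gaussianTail (ω : Fin n → ℝ × ℝ) :
    gaussianBlock m ω + gaussianTail m ω = ∑ j, (ω j).1 :=
  Finset.sum_filter_add_sum_filter_not _ _ _

lemma card_filter_val_lt (hm : m ≤ n) : #{j : Fin n | j.val < m} = m := by
  simp [Fin.card_filter_val_lt, hm]

lemma card_filter_not_val_lt (hm : m ≤ n) : #{j : Fin n | ¬ j.val < m} = n - m := by
  have h := Finset.card_filter_add_card_filter_not (s := (univ : Finset (Fin n))) (fun j => j.val < m)
  rw [card_filter_val_lt hm, Finset.card_univ, Fintype.card_fin] at h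
  omega

lemma map_gaussianBlock_prod_gaussianTail (hm : m ≤ n) :
    (innovationLaw n b).map (fun ω => (gaussianBlock m ω, gaussianTail m ω)) =
      (gaussianReal 0 (m : ℝ≥0)).prod (gaussianReal 0 ((n - m : ℕ) : ℝ≥0)) := by
  have hX : Measurable (gaussianBlock (n := n) m) := by unfold gaussianBlock; fun_prop
  have hG : Measurable (gaussianTail (n := n) m) := by unfold gaussianTail; fun_prop
  have hind : IndepFun (gaussianBlock m) (gaussianTail m) (innovationLaw n b) := by
    have h := (iIndepFun_gaussian n b).indepFun_finset {j : Fin n | j.val < m}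
      {j : Fin n | ¬ j.val < m} (Finset.disjoint_filter_filter_not _ _ _) (fun i => by fun_prop)
    have h' := h.comp (φ := fun x => ∑ i, x i) (ψ := fun x => ∑ i, x i) (by fun_prop) (by fun_prop)
    convert h' using 1
    · funext ω
      exact (Finset.sum_coe_sort _ fun i => (ω i).1).symm
    · funext ω
      exact (Finset.sum_coe_sort _ fun i => (ω i).1).symm
  rw [(indepFun_iff_map_prod_eq_prod_map_map hX.aemeasurable hG.aemeasurable).1 hind]
  have h1 := map_sum_innovation (b := b) {j : Fin n | j.val < m}
  have h2 := map_sum_innovation (b := b) {j : Fin n | ¬ j.val < m}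
  rw [card_filter_val_lt hm] at h1
  rw [card_filter_not_val_lt hm] at h2
  rw [← h1, ← h2]
  rfl

lemma measureReal_sum_le (hn : n ≠ 0) (t : ℝ) :
    (innovationLaw n b).real {ω | ∑ j, (ω j).1 ≤ t * √n} = gaussCDF 1 t := by
  have hn0 : (0 : ℝ) < √n := Real.sqrt_pos.2 (by positivity)
  have h := map_sum_innovation (b := b) (univ : Finset (Fin n))
  have hstd : gaussianReal 0 (n : ℝ≥0) = (gaussianReal 0 1).map (fun x => √n * x) := by
    rw [gaussianReal_map_const_mul]
    congr 1
    · simp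
    · ext
      simp
  rw [Finset.card_univ, Fintype.card_fin, hstd] at h
  have h' : (innovationLaw n b).real {ω | ∑ j, (ω j).1 ≤ t * √n} =
      ((innovationLaw n b).map (fun ω => ∑ j, (ω j).1)).real (Set.Iic (t * √n)) :=
    (map_measureReal_apply (f := fun ω : Fin n → ℝ × ℝ => ∑ j, (ω j).1) (by fun_prop)
      measurableSet_Iic).symm
  rw [h', h, map_measureReal_apply (measurable_const_mul _) measurableSet_Iic, gaussCDF, Measure.real]
  congr 2
  ext x
  simp only [Set.mem_preimage, Set.mem_Iic, mul_comm t, mul_le_mul_iff_right₀ hn0]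

/-- Off the window the sum of the increments is Gaussian; on the window it is bounded above. -/
lemma add_le_measureReal_sum_switchedIncrement (hm : m ≤ n) (hb : 0 < b) {T : ℝ}
    (hT : r + ((n - m : ℕ) : ℝ) / b ≤ T) :
    (innovationLaw n b).real {ω | ∑ j, (ω j).1 ≤ T} +
      ((gaussianReal 0 (m : ℝ≥0)).prod (gaussianReal 0 ((n - m : ℕ) : ℝ≥0))).real
        {z | |z.1| ≤ r ∧ T < z.1 + z.2} ≤
      (innovationLaw n b).real {ω | ∑ k, switchedIncrement m r k ω ≤ T} := by
  have hmeas : MeasurableSet {z : ℝ × ℝ | |z.1| ≤ r ∧ T < z.1 + z.2} :=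
    (measurableSet_le (f := fun z : ℝ × ℝ => |z.1|) (by fun_prop) measurable_const).inter
      (measurableSet_lt (g := fun z : ℝ × ℝ => z.1 + z.2) measurable_const (by fun_prop))
  have hXG : Measurable fun ω : Fin n → ℝ × ℝ => (gaussianBlock m ω, gaussianTail m ω) := by
    unfold gaussianBlock gaussianTail
    fun_prop
  have hZ : ∀ᵐ ω ∂(innovationLaw n b), ∀ k, (ω k).2 ≤ 1 / b := by
    rw [ae_all_iff]
    exact fun k => (measurePreserving_twoPoint k).quasiMeasurePreserving.ae (ae_twoPoint_le hb)
  rw [← map_gaussianBlock_prod_gaussianTail (b := b) hm, map_measureReal_apply hXG hmeas,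
    ← measureReal_union ?_ (hXG hmeas)]
  · refine ENNReal.toReal_mono (measure_ne_top _ _) (measure_mono_ae ?_)
    filter_upwards [hZ] with ω hω hmem
    change ∑ k, switchedIncrement m r k ω ≤ T
    by_cases hA : |gaussianBlock m ω| ≤ r
    · rw [← Finset.sum_filter_add_sum_filter_not univ (fun j : Fin n => j.val < m)]
      have h1 : ∑ k with k.val < m, switchedIncrement m r k ω = gaussianBlock m ω :=
        Finset.sum_congr rfl fun k hk =>
          switchedIncrement_of_not_window fun h => absurd (Finset.mem_filter.1 hk).2 (not_lt.2 h.1)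
      have h2 : ∑ k with ¬ k.val < m, switchedIncrement m r k ω ≤
          ∑ k : Fin n with ¬ k.val < m, 1 / b :=
        Finset.sum_le_sum fun k hk => by
          rw [switchedIncrement_of_window (not_lt.1 (Finset.mem_filter.1 hk).2) hA]
          exact hω k
      rw [Finset.sum_const, card_filter_not_val_lt hm, nsmul_eq_mul, mul_one_div] at h2
      linarith [le_abs_self (gaussianBlock m ω)]
    · have h1 : ∑ k, switchedIncrement m r k ω = ∑ k, (ω k).1 :=
        Finset.sum_congr rfl fun k _ => switchedIncrement_of_not_window fun h => hA h.2
      rw [h1]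
      rcases hmem with h | h
      · exact h
      · exact absurd h.1 hA
  · rw [Set.disjoint_left]
    intro ω h1 h2
    have h3 : T < gaussianBlock m ω + gaussianTail m ω := h2.2
    rw [gaussianBlock_add_gaussianTail] at h3
    exact absurd h1 (not_le.2 h3)

lemma measureReal_switchEvent_le (hm : m ≤ n) (hm0 : m ≠ 0) (hr : 0 ≤ r) (k : Fin n) :
    (innovationLaw n b).real (switchEvent m r k) ≤ 2 * r * (√(2 * Real.pi * m))⁻¹ := by
  have h1 := map_sum_innovation (b := b) {j : Fin n | j.val < m}
  rw [card_filter_val_lt hm] at h1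
  calc (innovationLaw n b).real (switchEvent m r k)
      ≤ (innovationLaw n b).real (gaussianBlock m ⁻¹' Set.Icc (-r) r) :=
        measureReal_mono fun ω hω => abs_le.1 hω.2
    _ = (gaussianReal 0 (m : ℝ≥0)).real (Set.Icc (-r) r) := by
        rw [← h1, map_measureReal_apply (by fun_prop) measurableSet_Icc]
        rfl
    _ ≤ (r - -r) * (√(2 * Real.pi * m))⁻¹ := by
        simpa using gaussianReal_zero_Icc_le (v := (m : ℝ≥0)) (by exact_mod_cast hm0)
          (show -r ≤ r by linarith)
    _ = _ := by ring

end Construction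

lemma rpow_le_of_block_length {a p q : ℝ} {n m : ℕ} (ha : 1 ≤ a) (hap : a ^ (p - 1) = √n)
    (hm : 0 < m) (hnm : (n : ℝ) ≤ 6 * m) (hq : q ≤ a * (√(2 * Real.pi * m))⁻¹) :
    q * (5 * a) ^ (p - 2) ≤ 5 ^ (p - 2) := by
  have ha0 : 0 < a := by linarith
  have hm0 : (0 : ℝ) < m := by exact_mod_cast hm
  have hle : √n ≤ √(2 * Real.pi * m) :=
    Real.sqrt_le_sqrt (by nlinarith [Real.pi_gt_three])
  have hmul : a * a ^ (p - 2) = √n := by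
    rw [← hap, show p - 1 = 1 + (p - 2) by ring, Real.rpow_add ha0, Real.rpow_one]
  have h1 : q * a ^ (p - 2) ≤ 1 := by
    calc q * a ^ (p - 2) ≤ a * (√(2 * Real.pi * m))⁻¹ * a ^ (p - 2) := by gcongr
      _ = √n / √(2 * Real.pi * m) := by rw [← hmul]; ring
      _ ≤ 1 := div_le_one_of_le₀ hle (by positivity)
  rw [Real.mul_rpow (by norm_num) ha0.le]
  have h5 : (0 : ℝ) ≤ 5 ^ (p - 2) := by positivity
  nlinarith

lemma le_window_gain {a R : ℝ} {n : ℕ} (hn : 0 < n) (ha : 0 < a) (hR : 0 < R) (hRa : R ≤ a)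
    (haR : a ^ 2 / 2 ≤ R ^ 2) :
    0.06 * (a / √n) ≤ (√(2 * Real.pi * n))⁻¹ *
      (R * (1 / 2 - (R / 2 + R ^ 2 / (5 * a)) * (√(2 * Real.pi * R ^ 2))⁻¹)) := by
  obtain ⟨h1, h2⟩ := sqrt_two_pi_bounds
  have hn0 : 0 < √(n : ℝ) := Real.sqrt_pos.2 (by exact_mod_cast hn)
  set σ := √(2 * Real.pi) with hσ
  have hσ0 : 0 < σ := by linarith
  have hRa' : 0.7 * a ≤ R := by nlinarith
  rw [Real.sqrt_mul (by positivity) (R ^ 2), Real.sqrt_sq hR.le,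
    Real.sqrt_mul (by positivity) (n : ℝ), ← hσ]
  have hs : R / a ≤ 1 := (div_le_one ha).2 hRa
  have hsplit : (R / 2 + R ^ 2 / (5 * a)) * (σ * R)⁻¹ = (1 / 2 + R / a / 5) * σ⁻¹ := by
    field_simp
  have hσi : σ⁻¹ ≤ 0.4 := by
    rw [inv_le_comm₀ hσ0 (by norm_num)]
    norm_num
    linarith
  have hfac : 0.22 ≤ 1 / 2 - (1 / 2 + R / a / 5) * σ⁻¹ := by
    have : (1 / 2 + R / a / 5) * σ⁻¹ ≤ (1 / 2 + 1 / 5) * 0.4 := by gcongr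
    linarith
  rw [hsplit, show (σ * √(n : ℝ))⁻¹ * (R * (1 / 2 - (1 / 2 + R / a / 5) * σ⁻¹)) =
    (R * (1 / 2 - (1 / 2 + R / a / 5) * σ⁻¹) / σ) / √n by field_simp, ← mul_div_assoc]
  gcongr
  rw [le_div_iff₀ hσ0]
  nlinarith

/-- Proposition 2.1 (from Dedecker–Merlevède–Rio): a non stationary martingale
difference sequence with unit conditional variances, uniformly bounded `p`-th
moments, and Berry–Esseen distance at least `0.06 n^{-(p-2)/(2p-2)}`. -/
theorem mds_berry_esseen_lower_bound (p : ℝ) (hp : 2 < p) (n : ℕ) (hn : 20 ≤ n) :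
    ∃ (Ω : Type) (mΩ : MeasurableSpace Ω) (μ : Measure Ω)
      (_ : IsProbabilityMeasure μ) (d : Fin n → Ω → ℝ),
      (∀ k, Measurable (d k)) ∧
      (∀ k : Fin n,
        μ[d k | ⨆ j : Fin n, ⨆ _ : (j : ℕ) < (k : ℕ),
            MeasurableSpace.comap (d j) inferInstance] =ᵐ[μ] 0) ∧
      (∀ k : Fin n,
        μ[fun ω => (d k ω) ^ 2 | ⨆ j : Fin n, ⨆ _ : (j : ℕ) < (k : ℕ),
            MeasurableSpace.comap (d j) inferInstance] =ᵐ[μ] fun _ => 1) ∧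
      (∀ k : Fin n,
        (∫ ω, |d k ω| ^ p ∂μ) ≤ (∫ x : ℝ, |x| ^ p ∂(gaussianReal 0 1)) + (5 : ℝ) ^ (p - 2)) ∧
      (0.06 * (n : ℝ) ^ (-(p - 2) / (2 * p - 2)) ≤
        ⨆ t : ℝ, |(μ {ω | (∑ k, d k ω) ≤ t * Real.sqrt n}).toReal - gaussCDF 1 t|) := by
  obtain ⟨a, N, ha, hap, hrate, hNa, haN, hNn⟩ := exists_block_length hp hn
  have ha0 : 0 < a := by linarith
  have hn20 : (20 : ℝ) ≤ n := by exact_mod_cast hn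
  have hn0 : (0 : ℝ) < √n := Real.sqrt_pos.2 (by linarith)
  have hN0 : (0 : ℝ) < N := lt_of_lt_of_le (by positivity) hNa
  have hN1 : N ≠ 0 := by rintro rfl; simp at hN0
  have hNle : N ≤ n := by
    have : (N : ℝ) ≤ n := by linarith
    exact_mod_cast this
  obtain ⟨m, rfl⟩ : ∃ m, n = m + N := ⟨n - N, by omega⟩
  have hmN : (N : ℝ) ≤ 3 * m ∧ (0 : ℝ) < m ∧ ((m + N : ℕ) : ℝ) ≤ 6 * m := by
    push_cast at hNn hn20 ⊢
    refine ⟨?_, ?_, ?_⟩ <;> linarith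
  obtain ⟨hN3, hmpos, hm6⟩ := hmN
  have hm0 : 0 < m := by exact_mod_cast hmpos
  have hsub : m + N - m = N := by omega
  set R : ℝ := √N with hR
  have hR2 : R ^ 2 = N := Real.sq_sqrt hN0.le
  have hR0 : 0 < R := Real.sqrt_pos.2 hN0
  have hRa : R ≤ a := Real.sqrt_le_iff.2 ⟨ha0.le, haN⟩
  set T : ℝ := R / 2 + R ^ 2 / (5 * a) with hT
  have hid : Integrable (fun x : ℝ => x) (gaussianReal 0 1) :=
    (memLp_id_gaussianReal (μ := 0) (v := 1) 1).integrable le_rfl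
  have hsq : Integrable (fun x : ℝ => x ^ 2) (gaussianReal 0 1) :=
    (memLp_id_gaussianReal (μ := 0) (v := 1) 2).integrable_sq
  have hvar : ∫ x, x ^ 2 ∂(gaussianReal 0 1) = 1 := by
    have h := variance_fun_id_gaussianReal (μ := 0) (v := 1)
    rw [variance_of_integral_eq_zero aemeasurable_id' integral_id_gaussianReal] at h
    simpa using h
  refine ⟨Fin (m + N) → ℝ × ℝ, inferInstance, innovationLaw (m + N) (5 * a), inferInstance,
    fun k => switchedIncrement m (R / 2) k, measurable_switchedIncrement, fun k => ?_, fun k => ?_,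
    fun k => ?_, ?_⟩
  · exact condExp_comp_switchedIncrement k (f := fun x => x) measurable_id hid
      integral_id_gaussianReal (integral_id_twoPoint (by positivity))
  · exact condExp_comp_switchedIncrement k (f := fun x => x ^ 2) (by fun_prop) hsq hvar
      (integral_sq_twoPoint (by positivity))
  · refine (integral_abs_rpow_switchedIncrement_le k hp.le (by linarith)).trans ?_
    gcongr
    refine rpow_le_of_block_length ha hap hm0 hm6
      ((measureReal_switchEvent_le (by omega) hm0.ne' (by positivity) k).trans ?_)
    gcongr
    linarith
  · set d := fun k : Fin (m + N) => switchedIncrement m (R / 2) k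
    have hbdd : BddAbove (Set.range fun t : ℝ =>
        |(innovationLaw (m + N) (5 * a) {ω | ∑ k, d k ω ≤ t * √((m + N : ℕ) : ℝ)}).toReal -
          gaussCDF 1 t|) := by
      refine ⟨1, ?_⟩
      rintro _ ⟨t, rfl⟩
      exact abs_sub_le_of_nonneg_of_le measureReal_nonneg measureReal_le_one measureReal_nonneg
        measureReal_le_one
    refine le_trans ?_ (le_ciSup hbdd (T / √((m + N : ℕ) : ℝ)))
    refine le_trans ?_ (le_abs_self _)
    rw [← measureReal_sum_le (n := m + N) (b := 5 * a) (by omega), div_mul_cancel₀ _ hn0.ne', hrate]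
    have hlow := add_le_measureReal_sum_switchedIncrement (n := m + N) (m := m) (r := R / 2)
      (b := 5 * a) (T := T) (by omega) (by positivity) (by rw [hsub, hT, hR2])
    have hκ : T * (√(2 * Real.pi * N))⁻¹ ≤ 1 / 2 - R / 2 * (√(2 * Real.pi * N))⁻¹ := by
      have hσ := sqrt_two_pi_bounds.1
      have hTR : T + R / 2 ≤ 1.2 * R := by
        have : R ^ 2 / (5 * a) ≤ R / 5 := by
          rw [div_le_div_iff₀ (by positivity) (by norm_num)]
          nlinarith
        rw [hT]
        linarith
      rw [le_sub_iff_add_le, ← add_mul, ← div_eq_mul_inv, Real.sqrt_mul (by positivity) (N : ℝ),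
        div_le_iff₀ (by positivity)]
      nlinarith
    have hgain := le_prod_gaussianReal_window (m := (m : ℝ≥0)) (N := (N : ℝ≥0))
      (by exact_mod_cast hm0.ne') (by exact_mod_cast hN1) (by simpa using hN3) (T := T)
      (by
        have : 0 ≤ R ^ 2 / (5 * a) := by positivity
        simp only [NNReal.coe_natCast]
        linarith)
      (by simpa using hκ)
    have hnum := le_window_gain (n := m + N) (by omega) ha0 hR0 hRa (by rw [hR2]; exact hNa)
    simp only [NNReal.coe_natCast] at hgain
    rw [← hT, hR2] at hnum
    rw [hsub] at hlow
    push_cast at hnum ⊢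
    change _ ≤ (innovationLaw (m + N) (5 * a)).real {ω | ∑ k, d k ω ≤ T} - _
    linarith
end
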